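/- Let (T_l)_{l∈ℤ} ⊂ B(H) and A = (T_{j−k}) a Toeplitz matrix that is a left Schur multiplier on B(ℓ²(H)). Then the operator Φ_A defined on H-valued trigonometric polynomials by Φ_A(Σ_l x_l e^{−ilt}) = Σ_l T_l(x_l) extends to a bounded linear operator from C(𝕋, H) to H, with ‖Φ_A‖ ≤ ‖A‖_{M_l(ℓ²(H))}. -/

import Mathlib

noncomputable section

/-- The Hilbert space `ℓ²(H)` of square-summable `H`-valued sequences. -/
abbrev ellTwo (H : Type) [NormedAddCommGroup H] [InnerProductSpace ℂ H] : Type :=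
  lp (fun _ : ℕ => H) 2

variable {H : Type} [NormedAddCommGroup H] [InnerProductSpace ℂ H] [CompleteSpace H]
  [TopologicalSpace.SeparableSpace H]

/-- A bounded operator `A` on `ℓ²(H)` is represented by the matrix `T = (T_{kj})`
(with `T k j ∈ B(H)`) if `(A (x e_j))_k = T_{kj} x` for all `j, k, x`. -/
def Represents (T : ℕ → ℕ → (H →L[ℂ] H))
    (A : ellTwo H →L[ℂ] ellTwo H) : Prop :=
  ∀ (j : ℕ) (x : H) (k : ℕ), A (lp.single 2 j x) k = T k j x

/-- `C` is a bound for `T` as a right Schur multiplier: for every bounded `B = (S_{kj})`,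
the Schur product `B * A = (S_{kj} ∘ T_{kj})` is bounded with norm at most `C ‖B‖`. -/
def IsRightMultBound (T : ℕ → ℕ → (H →L[ℂ] H)) (C : ℝ) : Prop :=
  ∀ (S : ℕ → ℕ → (H →L[ℂ] H)) (B : ellTwo H →L[ℂ] ellTwo H), Represents S B →
    ∃ AB : ellTwo H →L[ℂ] ellTwo H,
      Represents (fun k j => (S k j).comp (T k j)) AB ∧ ‖AB‖ ≤ C * ‖B‖

/-- `C` is a bound for `T` as a left Schur multiplier: for every bounded `B = (S_{kj})`,
the Schur product `A * B = (T_{kj} ∘ S_{kj})` is bounded with norm at most `C ‖B‖`. -/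
def IsLeftMultBound (T : ℕ → ℕ → (H →L[ℂ] H)) (C : ℝ) : Prop :=
  ∀ (S : ℕ → ℕ → (H →L[ℂ] H)) (B : ellTwo H →L[ℂ] ellTwo H), Represents S B →
    ∃ AB : ellTwo H →L[ℂ] ellTwo H,
      Represents (fun k j => (T k j).comp (S k j)) AB ∧ ‖AB‖ ≤ C * ‖B‖

/-- The right Schur-multiplier norm `‖T‖_{M_r(ℓ²(H))}`. -/
def rightMultNorm (T : ℕ → ℕ → (H →L[ℂ] H)) : ℝ :=
  sInf {C : ℝ | 0 ≤ C ∧ IsRightMultBound T C}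

/-- The left Schur-multiplier norm `‖T‖_{M_l(ℓ²(H))}`. -/
def leftMultNorm (T : ℕ → ℕ → (H →L[ℂ] H)) : ℝ :=
  sInf {C : ℝ | 0 ≤ C ∧ IsLeftMultBound T C}

instance : Fact (0 < 2 * Real.pi) := ⟨by positivity⟩

section Helpers

open AddCircle MeasureTheory Filter Topology

variable {E : Type} [NormedAddCommGroup E] [InnerProductSpace ℂ E] [CompleteSpace E]

/-- Trigonometric polynomial with coefficients `b`. -/
def trigPoly (s : Finset ℤ) (b : ℤ → E) : C(AddCircle (2 * Real.pi), E) :=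
  ∑ k ∈ s, (fourier k : C(AddCircle (2 * Real.pi), ℂ)) •
    ContinuousMap.const (AddCircle (2 * Real.pi)) (b k)

theorem trigPoly_apply (s : Finset ℤ) (b : ℤ → E) (t : AddCircle (2 * Real.pi)) :
    trigPoly s b t = ∑ k ∈ s, (fourier k t : ℂ) • b k := by
  simp [trigPoly, -fourier_apply]

theorem integrable_cont {F : Type} [NormedAddCommGroup F] {f : AddCircle (2 * Real.pi) → F}
    (hf : Continuous f) :
    Integrable f (haarAddCircle (T := 2 * Real.pi)) := by
  exact hf.integrable_of_hasCompactSupport (HasCompactSupport.of_compactSpace f)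

theorem fourierCoeff_fourier_mul (f : C(AddCircle (2 * Real.pi), E)) (k n : ℤ) :
    fourierCoeff (fun t => (fourier k t : ℂ) • f t) n = fourierCoeff f (n - k) := by
  unfold fourierCoeff
  congr 1
  ext t
  rw [smul_smul, ← fourier_add]
  congr 3
  ring

theorem fourierCoeff_smul_const (l n : ℤ) (x : E) :
    fourierCoeff (fun t : AddCircle (2 * Real.pi) => (fourier l t : ℂ) • x) n
      = if n = l then x else 0 := by
  have h1 := congrFun (fourierCoeff_fourier (T := 2 * Real.pi) l) n
  have h2 : fourierCoeff (fun t : AddCircle (2 * Real.pi) => (fourier l t : ℂ) • x) n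
      = fourierCoeff (fourier l : AddCircle (2 * Real.pi) → ℂ) n • x := by
    unfold fourierCoeff
    rw [← integral_smul_const]
    congr 1
    ext t
    rw [smul_assoc]
  rw [h2, h1]
  by_cases h : n = l
  · subst h; simp
  · simp [h]

theorem fourierCoeff_sum_smul {ι : Type} (s : Finset ι) (a : ι → ℂ) (m : ι → ℤ)
    (f : C(AddCircle (2 * Real.pi), E)) (n : ℤ) :
    fourierCoeff (fun t => (∑ j ∈ s, a j * (fourier (m j) t : ℂ)) • f t) n
      = ∑ j ∈ s, a j • fourierCoeff f (n - m j) := by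
  simp_rw [← fourierCoeff_fourier_mul]
  unfold fourierCoeff
  simp_rw [← integral_smul]
  rw [← integral_finsetSum]
  · congr 1
    ext t
    rw [Finset.sum_smul, Finset.smul_sum]
    refine Finset.sum_congr rfl fun j _ => ?_
    rw [smul_smul, smul_smul, smul_smul]
    congr 1
    ring
  · intro j _
    apply integrable_cont
    fun_prop

theorem integral_inner_trigPoly (s : Finset ℤ) (b : ℤ → E) (g : C(AddCircle (2 * Real.pi), E)) :
    ∫ t, inner ℂ (trigPoly s b t) (g t) ∂(haarAddCircle (T := 2 * Real.pi))
      = ∑ k ∈ s, inner ℂ (b k) (fourierCoeff g k) := by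
  unfold fourierCoeff
  have h : ∀ k : ℤ, inner ℂ (b k) (∫ t, (fourier (-k) t : ℂ) • g t ∂(haarAddCircle (T := 2 * Real.pi)))
      = ∫ t, inner ℂ (b k) ((fourier (-k) t : ℂ) • g t) ∂(haarAddCircle (T := 2 * Real.pi)) := by
    intro k
    rw [integral_inner]
    apply integrable_cont
    fun_prop
  simp_rw [h]
  rw [← integral_finsetSum]
  · congr 1
    ext t
    rw [trigPoly_apply, sum_inner]
    refine Finset.sum_congr rfl fun k _ => ?_
    rw [inner_smul_left, inner_smul_right, fourier_neg]
  · intro k _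
    apply integrable_cont
    fun_prop

theorem fourierCoeff_trigPoly (s : Finset ℤ) (b : ℤ → E) (n : ℤ) (hn : n ∈ s) :
    fourierCoeff (trigPoly s b) n = b n := by
  have h : (trigPoly s b : AddCircle (2 * Real.pi) → E)
      = ∑ k ∈ s, fun t => (fourier k t : ℂ) • b k := by
    ext t; rw [trigPoly_apply, Finset.sum_apply]
  rw [h, fourierCoeff.sum]
  · rw [Finset.sum_apply]
    simp_rw [fourierCoeff_smul_const]
    simp [hn]
  · intro k _
    apply integrable_cont
    fun_prop

theorem integral_inner_self_trigPoly (s : Finset ℤ) (b : ℤ → E) :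
    ∫ t, inner ℂ (trigPoly s b t) (trigPoly s b t) ∂(haarAddCircle (T := 2 * Real.pi))
      = ((∑ k ∈ s, ‖b k‖ ^ 2 : ℝ) : ℂ) := by
  rw [integral_inner_trigPoly]
  push_cast
  refine Finset.sum_congr rfl fun k hk => ?_
  rw [fourierCoeff_trigPoly s b k hk, inner_self_eq_norm_sq_to_K]
  rfl

theorem integral_inner_self_eq (g : C(AddCircle (2 * Real.pi), E)) :
    ∫ t, inner ℂ (g t) (g t) ∂(haarAddCircle (T := 2 * Real.pi))
      = ((∫ t, ‖g t‖ ^ 2 ∂(haarAddCircle (T := 2 * Real.pi)) : ℝ) : ℂ) := by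
  rw [← integral_complex_ofReal]
  congr 1
  ext t
  rw [inner_self_eq_norm_sq_to_K]
  push_cast
  rfl

theorem parseval_trigPoly (s : Finset ℤ) (b : ℤ → E) :
    ∫ t, ‖trigPoly s b t‖ ^ 2 ∂(haarAddCircle (T := 2 * Real.pi)) = ∑ k ∈ s, ‖b k‖ ^ 2 := by
  have := integral_inner_self_trigPoly s b
  rw [integral_inner_self_eq] at this
  exact_mod_cast this

theorem bessel (s : Finset ℤ) (g : C(AddCircle (2 * Real.pi), E)) :
    ∑ k ∈ s, ‖fourierCoeff g k‖ ^ 2 ≤ ∫ t, ‖g t‖ ^ 2 ∂(haarAddCircle (T := 2 * Real.pi)) := by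
  set b : ℤ → E := fun k => fourierCoeff g k with hb
  set q := trigPoly s b with hq
  have h1 : ∫ t, inner ℂ (q t) (g t) ∂(haarAddCircle (T := 2 * Real.pi))
      = ((∑ k ∈ s, ‖b k‖ ^ 2 : ℝ) : ℂ) := by
    rw [hq, integral_inner_trigPoly]
    push_cast
    refine Finset.sum_congr rfl fun k hk => ?_
    rw [inner_self_eq_norm_sq_to_K]
    rfl
  have h1' : ∫ t, (inner ℂ (q t) (g t)).re ∂(haarAddCircle (T := 2 * Real.pi))
      = ∑ k ∈ s, ‖b k‖ ^ 2 := by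
    have := integral_re (𝕜 := ℂ) (μ := haarAddCircle (T := 2 * Real.pi))
      (f := fun t => inner ℂ (q t) (g t)) (integrable_cont (by fun_prop))
    rw [h1] at this
    refine this.trans ?_
    exact Complex.ofReal_re _
  have h2 := parseval_trigPoly s b
  have h3 : 0 ≤ ∫ t, ‖q t - g t‖ ^ 2 ∂(haarAddCircle (T := 2 * Real.pi)) :=
    integral_nonneg fun t => by positivity
  have h4 : ∫ t, ‖q t - g t‖ ^ 2 ∂(haarAddCircle (T := 2 * Real.pi))
      = ∫ t, ‖q t‖ ^ 2 ∂(haarAddCircle (T := 2 * Real.pi))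
        - 2 * ∫ t, (inner ℂ (q t) (g t)).re ∂(haarAddCircle (T := 2 * Real.pi))
        + ∫ t, ‖g t‖ ^ 2 ∂(haarAddCircle (T := 2 * Real.pi)) := by
    rw [← integral_const_mul, ← integral_sub, ← integral_add]
    · congr 1
      ext t
      exact norm_sub_sq (𝕜 := ℂ) (q t) (g t)
    all_goals
      apply integrable_cont
      fun_prop
  rw [h4, h1', h2] at h3
  linarith

/-- Fourier coefficients of the product of a scalar trigonometric polynomial with `f`. -/
theorem toeplitz_bound (N : ℕ) (a : ℕ → ℂ) (f : C(AddCircle (2 * Real.pi), E)) :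
    ∑ k ∈ Finset.range N, ‖∑ j ∈ Finset.range N, a j • fourierCoeff f ((k : ℤ) - j)‖ ^ 2
      ≤ ‖f‖ ^ 2 * ∑ j ∈ Finset.range N, ‖a j‖ ^ 2 := by
  set s : Finset ℤ := (Finset.range N).map Nat.castEmbedding with hs
  set p : C(AddCircle (2 * Real.pi), ℂ) := trigPoly s (fun n => a n.toNat) with hp
  have hpt : ∀ t, p t = ∑ j ∈ Finset.range N, a j * (fourier (j : ℤ) t : ℂ) := by
    intro t
    rw [hp, trigPoly_apply, hs, Finset.sum_map]
    refine Finset.sum_congr rfl fun j _ => ?_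
    simp [mul_comm, -fourier_apply]
  have h1 := bessel s (p • f)
  have h2 := parseval_trigPoly s (fun n => a n.toNat)
  rw [hs, Finset.sum_map] at h1 h2
  have h3 : ∀ k : ℤ, fourierCoeff (p • f : C(AddCircle (2 * Real.pi), E)) k
      = ∑ j ∈ Finset.range N, a j • fourierCoeff f (k - j) := by
    intro k
    rw [← fourierCoeff_sum_smul]
    congr 1
    ext t
    rw [← hpt]
    rfl
  simp_rw [h3] at h1
  refine h1.trans ?_
  have h5 : ∑ j ∈ Finset.range N, ‖a j‖ ^ 2
      = ∫ t, ‖p t‖ ^ 2 ∂(haarAddCircle (T := 2 * Real.pi)) := by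
    rw [hp, hs, h2]
    simp
  rw [h5, ← integral_const_mul]
  apply integral_mono
  · apply integrable_cont
    fun_prop
  · apply integrable_cont
    fun_prop
  · intro t
    have : ‖(p • f) t‖ ≤ ‖f‖ * ‖p t‖ := by
      change ‖p t • f t‖ ≤ _
      rw [norm_smul, mul_comm]
      gcongr
      exact f.norm_coe_le_norm t
    calc ‖(p • f) t‖ ^ 2 ≤ (‖f‖ * ‖p t‖) ^ 2 := by gcongr
      _ = _ := by ring

/-- The finite Toeplitz operator with symbol `f`. -/
def toepLin (N : ℕ) (u : E) (f : C(AddCircle (2 * Real.pi), E)) :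
    ellTwo E →ₗ[ℂ] ellTwo E where
  toFun y := ∑ k ∈ Finset.range N, lp.single 2 k
    (∑ j ∈ Finset.range N, (inner ℂ u (y j) : ℂ) • fourierCoeff f ((k : ℤ) - j))
  map_add' y z := by
    rw [← Finset.sum_add_distrib]
    refine Finset.sum_congr rfl fun k _ => ?_
    rw [← lp.single_add, ← Finset.sum_add_distrib]
    congr 1
    refine Finset.sum_congr rfl fun j _ => ?_
    rw [← add_smul, ← inner_add_right]
    rfl
  map_smul' c y := by
    rw [Finset.smul_sum]
    refine Finset.sum_congr rfl fun k _ => ?_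
    rw [← lp.single_smul, Finset.smul_sum]
    congr 1
    refine Finset.sum_congr rfl fun j _ => ?_
    rw [smul_smul]
    congr 1
    change inner ℂ u (c • y j) = _
    rw [inner_smul_right]
    rfl

theorem toepLin_bound (N : ℕ) (u : E) (hu : ‖u‖ = 1) (f : C(AddCircle (2 * Real.pi), E))
    (y : ellTwo E) : ‖toepLin N u f y‖ ≤ ‖f‖ * ‖y‖ := by
  have h2 : (0 : ℝ) < (2 : ENNReal).toReal := by simp
  have h := lp.norm_sum_single (E := fun _ : ℕ => E) h2
    (fun k => ∑ j ∈ Finset.range N, (inner ℂ u (y j) : ℂ) • fourierCoeff f ((k : ℤ) - j))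
    (Finset.range N)
  have h' := lp.sum_rpow_le_norm_rpow h2 y (Finset.range N)
  simp only [ENNReal.toReal_ofNat, Real.rpow_ofNat] at h h'
  have h3 := toeplitz_bound N (fun j => inner ℂ u (y j)) f
  refine (sq_le_sq₀ (norm_nonneg _) (by positivity)).1 ?_
  change ‖∑ k ∈ Finset.range N, lp.single 2 k
    (∑ j ∈ Finset.range N, (inner ℂ u (y j) : ℂ) • fourierCoeff f ((k : ℤ) - j))‖ ^ 2 ≤ _
  rw [h, mul_pow]
  refine h3.trans ?_
  gcongr
  refine le_trans ?_ h'
  gcongr with j _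
  refine (norm_inner_le_norm _ _).trans ?_
  rw [hu, one_mul]

/-- The Fejér type sums. -/
def fejer (T : ℤ → (E →L[ℂ] E)) (N : ℕ) (f : C(AddCircle (2 * Real.pi), E)) : E :=
  (N : ℂ)⁻¹ • ∑ k ∈ Finset.range N, ∑ j ∈ Finset.range N,
    T ((j : ℤ) - k) (fourierCoeff f ((k : ℤ) - j))

theorem fejer_add (T : ℤ → (E →L[ℂ] E)) (N : ℕ) (f g : C(AddCircle (2 * Real.pi), E)) :
    fejer T N (f + g) = fejer T N f + fejer T N g := by
  unfold fejer
  rw [ContinuousMap.coe_add, fourierCoeff.add (integrable_cont f.continuous)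
    (integrable_cont g.continuous)]
  simp [Finset.sum_add_distrib]

theorem fejer_smul (T : ℤ → (E →L[ℂ] E)) (N : ℕ) (c : ℂ) (f : C(AddCircle (2 * Real.pi), E)) :
    fejer T N (c • f) = c • fejer T N f := by
  unfold fejer
  rw [ContinuousMap.coe_smul]
  simp_rw [fourierCoeff.const_smul, map_smul, ← Finset.smul_sum]
  rw [smul_comm]

theorem fejer_bound (T : ℤ → (E →L[ℂ] E)) (C : ℝ) (hC0 : 0 ≤ C)
    (hC : IsLeftMultBound (fun k j => T ((j : ℤ) - (k : ℤ))) C) (N : ℕ)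
    (f : C(AddCircle (2 * Real.pi), E)) : ‖fejer T N f‖ ≤ C * ‖f‖ := by
  rcases subsingleton_or_nontrivial E with hE | hE
  · rw [Subsingleton.elim (fejer T N f) 0, norm_zero]; positivity
  rcases Nat.eq_zero_or_pos N with rfl | hN
  · simp only [fejer, Finset.range_zero, Finset.sum_empty, smul_zero, norm_zero]; positivity
  obtain ⟨u, hu⟩ := exists_norm_eq E (zero_le_one (α := ℝ))
  set B : ellTwo E →L[ℂ] ellTwo E := (toepLin N u f).mkContinuous ‖f‖ (toepLin_bound N u hu f)
    with hB
  have hBn : ‖B‖ ≤ ‖f‖ := LinearMap.mkContinuous_norm_le _ (norm_nonneg f) _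
  set S : ℕ → ℕ → (E →L[ℂ] E) := fun k j => if k < N ∧ j < N then
    (innerSL ℂ u).smulRight (fourierCoeff f ((k : ℤ) - j)) else 0 with hS
  have hrep : Represents S B := by
    intro j x k
    change (∑ k ∈ Finset.range N, lp.single 2 k (∑ i ∈ Finset.range N,
      (inner ℂ u ((lp.single 2 j x : ellTwo E) i) : ℂ) • fourierCoeff f ((k : ℤ) - i)) : ellTwo E) k = _
    rw [lp.coeFn_sum, Finset.sum_apply]
    simp only [lp.coeFn_single, Finset.sum_pi_single, Finset.mem_range, hS, Pi.single_apply,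
      apply_ite (inner ℂ u), inner_zero_right, ite_smul, zero_smul, Finset.sum_ite_eq']
    by_cases hk : k < N <;> by_cases hj : j < N <;> simp [hk, hj]
  obtain ⟨AB, hAB, hABn⟩ := hC S B hrep
  set y : ellTwo E := ∑ j ∈ Finset.range N, lp.single 2 j u with hy
  have h2 : (0 : ℝ) < (2 : ENNReal).toReal := by simp
  have hyn := lp.norm_sum_single (E := fun _ : ℕ => E) h2 (fun _ => u) (Finset.range N)
  have hz := lp.sum_rpow_le_norm_rpow h2 (AB y) (Finset.range N)
  simp only [ENNReal.toReal_ofNat, Real.rpow_ofNat, hu, one_pow, Finset.sum_const,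
    Finset.card_range, nsmul_eq_mul, mul_one] at hyn hz
  rw [← hy] at hyn
  have hABy : ∀ k ∈ Finset.range N, AB y k
      = ∑ j ∈ Finset.range N, T ((j : ℤ) - k) (fourierCoeff f ((k : ℤ) - j)) := by
    intro k hk
    rw [hy, map_sum, lp.coeFn_sum, Finset.sum_apply]
    refine Finset.sum_congr rfl fun j hj => ?_
    rw [hAB j u k]
    have hk' := Finset.mem_range.1 hk
    have hj' := Finset.mem_range.1 hj
    simp [hS, hk', hj', hu]
  have hsum : ‖∑ k ∈ Finset.range N, AB y k‖ ≤ N * (C * ‖f‖) := by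
    refine (sq_le_sq₀ (norm_nonneg _) (by positivity)).1 ?_
    have e1 : ‖∑ k ∈ Finset.range N, AB y k‖ ^ 2 ≤ (∑ k ∈ Finset.range N, ‖AB y k‖) ^ 2 := by
      gcongr; exact norm_sum_le _ _
    have e2 : (∑ k ∈ Finset.range N, ‖AB y k‖) ^ 2 ≤ N * ∑ k ∈ Finset.range N, ‖AB y k‖ ^ 2 := by
      simpa using sq_sum_le_card_mul_sum_sq (s := Finset.range N) (f := fun k => ‖AB y k‖)
    have e3 : ‖AB y‖ ≤ C * ‖f‖ * ‖y‖ := by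
      refine (AB.le_opNorm y).trans ?_
      gcongr
      exact hABn.trans (by gcongr)
    calc ‖∑ k ∈ Finset.range N, AB y k‖ ^ 2 ≤ N * ‖AB y‖ ^ 2 := e1.trans (e2.trans (by gcongr))
      _ ≤ N * (C * ‖f‖ * ‖y‖) ^ 2 := by gcongr
      _ = N * ((C * ‖f‖) ^ 2 * ‖y‖ ^ 2) := by ring
      _ = (N * (C * ‖f‖)) ^ 2 := by rw [hyn]; ring
  rw [Finset.sum_congr rfl hABy] at hsum
  unfold fejer
  rw [norm_smul, norm_inv, Complex.norm_natCast]
  have hN' : (0 : ℝ) < N := by exact_mod_cast hN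
  rw [inv_mul_le_iff₀ hN']
  exact hsum

theorem fejer_tendsto (T : ℤ → (E →L[ℂ] E)) (l : ℤ) (x : E) :
    Tendsto (fun N => fejer T N ((fourier (-l) : C(AddCircle (2 * Real.pi), ℂ)) •
          (ContinuousMap.const (AddCircle (2 * Real.pi)) x))) atTop (𝓝 (T l x)) := by
  have key : ∀ N : ℕ, l.natAbs ≤ N → fejer T N ((fourier (-l) : C(AddCircle (2 * Real.pi), ℂ)) •
          (ContinuousMap.const (AddCircle (2 * Real.pi)) x))
        = ((N : ℂ)⁻¹ * ((N : ℂ) - (l.natAbs : ℂ))) • T l x := by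
    intro N hN
    have hc : ∀ n : ℤ, fourierCoeff ((fourier (-l) : C(AddCircle (2 * Real.pi), ℂ)) •
          (ContinuousMap.const (AddCircle (2 * Real.pi)) x)) n = if n = -l then x else 0 :=
      fun n => fourierCoeff_smul_const (-l) n x
    unfold fejer
    rw [mul_smul]
    congr 1
    have h1 : ∀ k ∈ Finset.range N, ∑ j ∈ Finset.range N, T ((j : ℤ) - k) (fourierCoeff
        ((fourier (-l) : C(AddCircle (2 * Real.pi), ℂ)) •
          (ContinuousMap.const (AddCircle (2 * Real.pi)) x)) ((k : ℤ) - j))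
        = if k ∈ Finset.Ico (-l).toNat (N - l.toNat) then T l x else 0 := by
      intro k hk
      have hk' := Finset.mem_range.1 hk
      have h3 : ∀ j : ℕ, T ((j : ℤ) - k) (fourierCoeff
        ((fourier (-l) : C(AddCircle (2 * Real.pi), ℂ)) •
          (ContinuousMap.const (AddCircle (2 * Real.pi)) x)) ((k : ℤ) - j))
          = if (j : ℤ) = k + l then T l x else 0 := by
        intro j
        rw [hc]
        by_cases h : (j : ℤ) = k + l
        · rw [if_pos h, if_pos (by omega)]
          congr 2
          omega
        · rw [if_neg h, if_neg (by omega), map_zero]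
      simp_rw [h3]
      by_cases h : k ∈ Finset.Ico (-l).toNat (N - l.toNat)
      · rw [if_pos h]
        have h' := Finset.mem_Ico.1 h
        rw [Finset.sum_eq_single ((k : ℤ) + l).toNat]
        · rw [if_pos (by omega)]
        · intro j _ hj
          rw [if_neg (by omega)]
        · intro hj
          exfalso
          apply hj
          rw [Finset.mem_range]
          omega
      · rw [if_neg h]
        refine Finset.sum_eq_zero fun j hj => ?_
        rw [Finset.mem_range] at hj
        rw [Finset.mem_Ico] at h
        rw [if_neg (by omega)]
    rw [Finset.sum_congr rfl h1, Finset.sum_ite_mem, Finset.inter_eq_right.2, Finset.sum_const,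
      Nat.card_Ico, ← Nat.cast_smul_eq_nsmul ℂ, ← Nat.cast_sub hN]
    · congr 2
      omega
    · intro k hk
      rw [Finset.mem_Ico] at hk
      rw [Finset.mem_range]
      omega
  have h1 : Tendsto (fun N : ℕ => ((N : ℂ)⁻¹ * ((N : ℂ) - (l.natAbs : ℂ)))) atTop (𝓝 1) := by
    have h2 : Tendsto (fun N : ℕ => (1 : ℂ) - (l.natAbs : ℂ) * (N : ℂ)⁻¹) atTop (𝓝 (1 - l.natAbs * 0)) :=
      tendsto_const_nhds.sub (tendsto_const_nhds.mul (tendsto_inv_atTop_nhds_zero_nat (𝕜 := ℂ)))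
    rw [mul_zero, sub_zero] at h2
    refine h2.congr' ?_
    filter_upwards [eventually_gt_atTop 0] with N hN
    have : (N : ℂ) ≠ 0 := by exact_mod_cast hN.ne'
    field_simp
  have h3 := h1.smul_const (T l x)
  rw [one_smul] at h3
  refine h3.congr' ?_
  filter_upwards [eventually_ge_atTop l.natAbs] with N hN
  exact (key N hN).symm

/-- Weak limits along an ultrafilter of bounded sequences in a Hilbert space. -/
theorem exists_weak_limit (v : ℕ → E) (C : ℝ) (hv : ∀ n, ‖v n‖ ≤ C) :
    ∃ w : E, ‖w‖ ≤ C ∧ ∀ z : E, Tendsto (fun n => (inner ℂ (v n) z : ℂ)) (hyperfilter ℕ)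
      (𝓝 (inner ℂ w z)) := by
  have hcomp := WeakDual.isCompact_closedBall (𝕜 := ℂ) (E := E) 0 C
  set g : ℕ → WeakDual ℂ E := fun n => StrongDual.toWeakDual (InnerProductSpace.toDual ℂ E (v n))
  obtain ⟨φ, hφ, hle⟩ := hcomp.ultrafilter_le_nhds ((hyperfilter ℕ).map g) (by
    rw [Ultrafilter.coe_map, le_principal_iff, mem_map]
    refine Filter.univ_mem' fun n => ?_
    simpa [g] using hv n)
  refine ⟨(InnerProductSpace.toDual ℂ E).symm (WeakDual.toStrongDual φ), ?_, fun z => ?_⟩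
  · simpa using hφ
  · have h1 : Tendsto g (hyperfilter ℕ) (𝓝 φ) := hle
    have h2 := ((WeakDual.eval_continuous (𝕜 := ℂ) (E := E) z).tendsto φ).comp h1
    rw [InnerProductSpace.toDual_symm_apply]
    exact h2

theorem weak_limit_unique {v : ℕ → E} {w w' : E}
    (h : ∀ z : E, Tendsto (fun n => (inner ℂ (v n) z : ℂ)) (hyperfilter ℕ) (𝓝 (inner ℂ w z)))
    (h' : ∀ z : E, Tendsto (fun n => (inner ℂ (v n) z : ℂ)) (hyperfilter ℕ) (𝓝 (inner ℂ w' z))) :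
    w = w' :=
  ext_inner_right ℂ fun z => tendsto_nhds_unique (h z) (h' z)

end Helpers

/-- if the Toeplitz matrix `A = (T_{j−k})` is a left Schur multiplier on
`B(ℓ²(H))`, then `Φ_A : Σ_l x_l e^{−ilt} ↦ Σ_l T_l(x_l)` extends to a bounded operator
`C(𝕋, H) → H` with `‖Φ_A‖ ≤ ‖A‖_{M_l(ℓ²(H))}`. -/
theorem left_multiplier_gives_phi (T : ℤ → (H →L[ℂ] H))
    (h : ∃ C : ℝ, 0 ≤ C ∧ IsLeftMultBound (fun k j => T ((j : ℤ) - (k : ℤ))) C) :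
    ∃ Φ : C(AddCircle (2 * Real.pi), H) →L[ℂ] H,
      (∀ (l : ℤ) (x : H),
        Φ ((fourier (-l) : C(AddCircle (2 * Real.pi), ℂ)) •
          (ContinuousMap.const (AddCircle (2 * Real.pi)) x)) = T l x) ∧
      ‖Φ‖ ≤ leftMultNorm (fun k j => T ((j : ℤ) - (k : ℤ))) := by
  classical
  set M := leftMultNorm (fun k j => T ((j : ℤ) - (k : ℤ))) with hM
  have hM0 : 0 ≤ M := Real.sInf_nonneg fun C hC => hC.1
  have hb : ∀ N (f : C(AddCircle (2 * Real.pi), H)), ‖fejer T N f‖ ≤ M * ‖f‖ := by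
    intro N f
    rcases (norm_nonneg f).eq_or_lt with h0 | h0
    · obtain ⟨C, hC0, hC⟩ := h
      have := fejer_bound T C hC0 hC N f
      rw [← h0] at this ⊢
      simpa using this
    · rw [← div_le_iff₀ h0]
      obtain ⟨C, hC0, hC⟩ := h
      refine le_csInf ⟨C, hC0, hC⟩ ?_
      rintro D ⟨hD0, hD⟩
      rw [div_le_iff₀ h0]
      exact fejer_bound T D hD0 hD N f
  choose Φ hΦn hΦ using fun f : C(AddCircle (2 * Real.pi), H) =>
    exists_weak_limit (fun N => fejer T N f) (M * ‖f‖) (fun N => hb N f)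
  let L : C(AddCircle (2 * Real.pi), H) →ₗ[ℂ] H :=
    { toFun := Φ
      map_add' := fun f g => weak_limit_unique (hΦ (f + g)) fun z => by
        simp_rw [fejer_add, inner_add_left]
        exact (hΦ f z).add (hΦ g z)
      map_smul' := fun c f => weak_limit_unique (hΦ (c • f)) fun z => by
        simp_rw [fejer_smul, RingHom.id_apply, inner_smul_left]
        exact (hΦ f z).const_mul _ }
  refine ⟨L.mkContinuous M hΦn, fun l x => ?_, LinearMap.mkContinuous_norm_le _ hM0 _⟩
  refine weak_limit_unique (hΦ _) fun z => ?_
  have h1 := fejer_tendsto T l x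
  have h2 := h1.mono_left Nat.hyperfilter_le_atTop
  exact h2.inner tendsto_const_nhds
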